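/- (Polynomial Pseudovariety Theorem) Let T be a monad on the category of sets, with finite alphabets being finite sets and finite T-algebras being those with finite universe. Then makelang is a bijection between algebra pseudovarieties and polynomial language pseudovarieties, with inverse makealg: for every algebra pseudovariety 𝔸, makelang 𝔸 is a polynomial language pseudovariety and makealg(makelang 𝔸) = 𝔸; and for every polynomial language pseudovariety 𝕃, makealg 𝕃 is an algebra pseudovariety and makelang(makealg 𝕃) = 𝕃. -/

import Mathlib

universe u

structure SetMonad : Type (u + 1) where
  T : Type u → Type u
  map : {X Y : Type u} → (X → Y) → T X → T Y
  unit : {X : Type u} → X → T X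
  mult : {X : Type u} → T (T X) → T X
  map_id : ∀ {X : Type u} (w : T X), map id w = w
  map_comp : ∀ {X Y Z : Type u} (g : Y → Z) (f : X → Y) (w : T X),
    map (g ∘ f) w = map g (map f w)
  unit_nat : ∀ {X Y : Type u} (f : X → Y) (x : X), map f (unit x) = unit (f x)
  mult_nat : ∀ {X Y : Type u} (f : X → Y) (w : T (T X)),
    map f (mult w) = mult (map (map f) w)
  mult_unit : ∀ {X : Type u} (w : T X), mult (unit w) = w
  mult_map_unit : ∀ {X : Type u} (w : T X), mult (map unit w) = w
  mult_assoc : ∀ {X : Type u} (w : T (T (T X))), mult (mult w) = mult (map mult w)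

structure SetMonad.Alg (M : SetMonad.{u}) : Type (u + 1) where
  carrier : Type u
  mul : M.T carrier → carrier
  mul_unit : ∀ a, mul (M.unit a) = a
  mul_assoc : ∀ w, mul (M.mult w) = mul (M.map mul w)

namespace SetMonad

variable (M : SetMonad.{u})

/-- `h` is a morphism of Eilenberg–Moore `T`-algebras. -/
def IsHom (A B : M.Alg) (h : A.carrier → B.carrier) : Prop :=
  ∀ w, h (A.mul w) = B.mul (M.map h w)

/-- The free `T`-algebra on a set. -/
def Free (Sig : Type u) : M.Alg where
  carrier := M.T Sig
  mul := M.mult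
  mul_unit := M.mult_unit
  mul_assoc := M.mult_assoc

/-- Unary polynomials over an algebra: elements of `T (A ⊕ {x})`. -/
def UPoly (A : M.Alg) : Type u := M.T (A.carrier ⊕ PUnit.{u + 1})

/-- Evaluation of a unary polynomial at a point. -/
def evalPoly (A : M.Alg) (p : M.UPoly A) (a : A.carrier) : A.carrier :=
  A.mul (M.map (Sum.elim id fun _ => a) p)

/-- Polynomial derivative of a language. -/
def deriv {Sig : Type u} (p : M.UPoly (M.Free Sig)) (L : Set (M.T Sig)) : Set (M.T Sig) :=
  {w | M.evalPoly (M.Free Sig) p w ∈ L}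

/-- A language is recognisable if it is a morphism preimage from a finite algebra. -/
def Recognisable (A : M.Alg) (L : Set A.carrier) : Prop :=
  ∃ (B : M.Alg) (h : A.carrier → B.carrier) (F : Set B.carrier),
    Finite B.carrier ∧ M.IsHom A B h ∧ L = h ⁻¹' F

/-- `h` is a syntactic morphism of `L`. -/
def IsSynMorphism {Sig : Type u} (L : Set (M.T Sig)) (B : M.Alg)
    (h : M.T Sig → B.carrier) : Prop :=
  Finite B.carrier ∧ M.IsHom (M.Free Sig) B h ∧ Function.Surjective h ∧
    ∀ w w' : M.T Sig, h w = h w' ↔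
      ∀ p : M.UPoly (M.Free Sig),
        (M.evalPoly (M.Free Sig) p w ∈ L ↔ M.evalPoly (M.Free Sig) p w' ∈ L)

/-- The product of two `T`-algebras. -/
def prodAlg (A B : M.Alg) : M.Alg where
  carrier := A.carrier × B.carrier
  mul w := (A.mul (M.map Prod.fst w), B.mul (M.map Prod.snd w))
  mul_unit a := by
    show (A.mul (M.map Prod.fst (M.unit a)), B.mul (M.map Prod.snd (M.unit a))) = a
    rw [M.unit_nat, M.unit_nat, A.mul_unit, B.mul_unit]
  mul_assoc w := by
    show (A.mul (M.map Prod.fst (M.mult w)), B.mul (M.map Prod.snd (M.mult w))) = _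
    rw [M.mult_nat, M.mult_nat, A.mul_assoc, B.mul_assoc,
      ← M.map_comp, ← M.map_comp]
    show _ = (A.mul (M.map Prod.fst (M.map _ w)), B.mul (M.map Prod.snd (M.map _ w)))
    rw [← M.map_comp, ← M.map_comp]
    rfl

/-- The subalgebra on a multiplication-closed subset. -/
def subAlg (A : M.Alg) (S : Set A.carrier)
    (hS : ∀ w : M.T ↥S, A.mul (M.map Subtype.val w) ∈ S) : M.Alg where
  carrier := ↥S
  mul w := ⟨A.mul (M.map Subtype.val w), hS w⟩
  mul_unit a := by
    apply Subtype.ext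
    show A.mul (M.map Subtype.val (M.unit a)) = a.val
    rw [M.unit_nat, A.mul_unit]
  mul_assoc w := by
    apply Subtype.ext
    show A.mul (M.map Subtype.val (M.mult w)) = A.mul (M.map Subtype.val (M.map _ w))
    rw [M.mult_nat, A.mul_assoc, ← M.map_comp, ← M.map_comp]
    rfl

/-- A class of finite `T`-algebras is an algebra pseudovariety if it is closed under
binary products, surjective morphic images, and subalgebras. -/
def IsAlgPV (P : M.Alg → Prop) : Prop :=
  (∀ A, P A → Finite A.carrier) ∧
  (∀ A B, P A → P B → P (M.prodAlg A B)) ∧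
  (∀ (A B : M.Alg) (h : A.carrier → B.carrier),
    P A → M.IsHom A B h → Function.Surjective h → P B) ∧
  (∀ (A : M.Alg) (S : Set A.carrier) (hS : ∀ w : M.T ↥S, A.mul (M.map Subtype.val w) ∈ S),
    P A → P (M.subAlg A S hS))

/-- All members of the class are T-languages: recognisable languages over finite alphabets. -/
def IsLangClass (P : ∀ Sig : Type u, Set (M.T Sig) → Prop) : Prop :=
  ∀ (Sig : Type u) (L : Set (M.T Sig)), P Sig L → Finite Sig ∧ M.Recognisable (M.Free Sig) L

/-- Closure under Boolean combinations over a common alphabet. -/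
def ClosedBool (P : ∀ Sig : Type u, Set (M.T Sig) → Prop) : Prop :=
  (∀ (Sig : Type u) (L K : Set (M.T Sig)), P Sig L → P Sig K → P Sig (L ∪ K)) ∧
  (∀ (Sig : Type u) (L K : Set (M.T Sig)), P Sig L → P Sig K → P Sig (L ∩ K)) ∧
  (∀ (Sig : Type u) (L : Set (M.T Sig)), P Sig L → P Sig Lᶜ)

/-- Closure under preimages of `T`-morphisms between free algebras on finite alphabets. -/
def ClosedPreimage (P : ∀ Sig : Type u, Set (M.T Sig) → Prop) : Prop :=
  ∀ (Sig Gam : Type u) (L : Set (M.T Sig)) (h : M.T Gam → M.T Sig),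
    Finite Gam → P Sig L → M.IsHom (M.Free Gam) (M.Free Sig) h → P Gam (h ⁻¹' L)

/-- Closure under polynomial derivatives. -/
def ClosedPolyDeriv (P : ∀ Sig : Type u, Set (M.T Sig) → Prop) : Prop :=
  ∀ (Sig : Type u) (L : Set (M.T Sig)) (p : M.UPoly (M.Free Sig)),
    P Sig L → P Sig (M.deriv p L)

/-- Closure under syntactic derivatives: all languages recognised by a syntactic
morphism of a member. -/
def ClosedSynDeriv (P : ∀ Sig : Type u, Set (M.T Sig) → Prop) : Prop :=
  ∀ (Sig : Type u) (L : Set (M.T Sig)) (B : M.Alg) (h : M.T Sig → B.carrier)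
    (F : Set B.carrier), P Sig L → M.IsSynMorphism L B h → P Sig (h ⁻¹' F)

/-- Syntactic language pseudovariety. -/
def IsSynLangPV (P : ∀ Sig : Type u, Set (M.T Sig) → Prop) : Prop :=
  M.IsLangClass P ∧ M.ClosedBool P ∧ M.ClosedPreimage P ∧ M.ClosedSynDeriv P

/-- Polynomial language pseudovariety. -/
def IsPolyLangPV (P : ∀ Sig : Type u, Set (M.T Sig) → Prop) : Prop :=
  M.IsLangClass P ∧ M.ClosedBool P ∧ M.ClosedPreimage P ∧ M.ClosedPolyDeriv P

/-- The class of T-languages recognised by some algebra of the class `P`. -/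
def makelang (P : M.Alg → Prop) : ∀ Sig : Type u, Set (M.T Sig) → Prop :=
  fun Sig L => Finite Sig ∧
    ∃ (B : M.Alg) (h : M.T Sig → B.carrier) (F : Set B.carrier),
      P B ∧ M.IsHom (M.Free Sig) B h ∧ L = h ⁻¹' F

/-- The class of finite `T`-algebras all of whose recognised languages belong to `P`. -/
def makealg (P : ∀ Sig : Type u, Set (M.T Sig) → Prop) : M.Alg → Prop :=
  fun B => Finite B.carrier ∧
    ∀ (Sig : Type u) (h : M.T Sig → B.carrier) (F : Set B.carrier),
      Finite Sig → M.IsHom (M.Free Sig) B h → P Sig (h ⁻¹' F)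

end SetMonad

namespace SetMonad

variable {M : SetMonad.{u}}

theorem IsHom.comp {A B C : M.Alg} {g : B.carrier → C.carrier} {f : A.carrier → B.carrier}
    (hg : M.IsHom B C g) (hf : M.IsHom A B f) : M.IsHom A C (g ∘ f) := by
  intro w
  rw [M.map_comp, ← hg, ← hf]
  rfl

theorem map_eq_self {X : Type u} {f : X → X} (hf : ∀ x, f x = x) (w : M.T X) :
    M.map f w = w := by
  rw [show f = id from funext hf, M.map_id]

theorem map_surjective {X Y : Type u} {f : X → Y} (hf : Function.Surjective f) :
    Function.Surjective (M.map f) := fun w =>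
  ⟨M.map (Function.surjInv hf) w, by
    rw [← M.map_comp]
    exact map_eq_self (Function.surjInv_eq hf) w⟩

theorem IsHom.of_comp_surjective {A B C : M.Alg} {g : B.carrier → C.carrier}
    {f : A.carrier → B.carrier} (hf : M.IsHom A B f) (hs : Function.Surjective f)
    (hgf : M.IsHom A C (g ∘ f)) : M.IsHom B C g := by
  intro w
  obtain ⟨v, rfl⟩ := map_surjective hs w
  have := hgf v
  rwa [M.map_comp, Function.comp_apply, hf] at this

theorem isHom_fst (A B : M.Alg) : M.IsHom (M.prodAlg A B) A Prod.fst := fun _ => rfl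

theorem isHom_snd (A B : M.Alg) : M.IsHom (M.prodAlg A B) B Prod.snd := fun _ => rfl

theorem isHom_prod {A B C : M.Alg} {f : A.carrier → B.carrier} {g : A.carrier → C.carrier}
    (hf : M.IsHom A B f) (hg : M.IsHom A C g) :
    M.IsHom A (M.prodAlg B C) fun a => (f a, g a) := by
  intro w
  refine Prod.ext ?_ ?_
  · change f _ = B.mul (M.map Prod.fst (M.map _ w))
    rw [← M.map_comp, hf]
    rfl
  · change g _ = C.mul (M.map Prod.snd (M.map _ w))
    rw [← M.map_comp, hg]
    rfl

theorem isHom_subtype_val (A : M.Alg) (S : Set A.carrier)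
    (hS : ∀ w : M.T ↥S, A.mul (M.map Subtype.val w) ∈ S) :
    M.IsHom (M.subAlg A S hS) A Subtype.val := fun _ => rfl

theorem IsHom.mul_mem_range {A B : M.Alg} {f : A.carrier → B.carrier} (hf : M.IsHom A B f)
    (w : M.T ↥(Set.range f)) : B.mul (M.map Subtype.val w) ∈ Set.range f := by
  refine ⟨A.mul (M.map (Set.rangeSplitting f) w), ?_⟩
  rw [hf, ← M.map_comp, Set.comp_rangeSplitting]

theorem IsHom.rangeFactorization {A B : M.Alg} {f : A.carrier → B.carrier}
    (hf : M.IsHom A B f) :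
    M.IsHom A (M.subAlg B (Set.range f) hf.mul_mem_range) (Set.rangeFactorization f) := by
  intro w
  apply Subtype.ext
  change f _ = B.mul (M.map Subtype.val (M.map _ w))
  rw [← M.map_comp, hf]
  rfl

/-- Morphisms out of a free algebra lift along surjective morphisms. -/
theorem IsHom.exists_lift {X : Type u} {A B : M.Alg} {q : A.carrier → B.carrier}
    (hq : M.IsHom A B q) (hs : Function.Surjective q) {h : M.T X → B.carrier}
    (hh : M.IsHom (M.Free X) B h) :
    ∃ g : M.T X → A.carrier, M.IsHom (M.Free X) A g ∧ ∀ w, q (g w) = h w := by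
  refine ⟨fun w => A.mul (M.map (fun x => Function.surjInv hs (h (M.unit x))) w), ?_, ?_⟩
  · intro (w : M.T (M.T X))
    change A.mul (M.map _ (M.mult w)) = _
    rw [M.mult_nat, A.mul_assoc, ← M.map_comp]
    rfl
  · intro w
    have hcomp : (q ∘ fun x => Function.surjInv hs (h (M.unit x))) = h ∘ M.unit :=
      funext fun x => Function.surjInv_eq hs _
    rw [hq, ← M.map_comp, hcomp, M.map_comp]
    exact (hh (M.map M.unit w)).symm.trans (congrArg h (M.mult_map_unit w))

theorem IsHom.map_evalPoly {A B : M.Alg} {h : A.carrier → B.carrier} (hh : M.IsHom A B h)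
    (p : M.T (A.carrier ⊕ PUnit.{u + 1})) (a : A.carrier) :
    h (M.evalPoly A p a) = M.evalPoly B (M.map (Sum.map h id) p) (h a) := by
  unfold evalPoly
  rw [hh, ← M.map_comp, ← M.map_comp]
  congr 2
  funext x
  cases x <;> rfl

theorem evalPoly_unit_inr (A : M.Alg) (a : A.carrier) :
    M.evalPoly A (M.unit (Sum.inr PUnit.unit)) a = a := by
  unfold evalPoly
  rw [M.unit_nat, A.mul_unit]
  rfl

/-- Unary polynomials compose. -/
theorem exists_evalPoly_comp (A : M.Alg) (q p : M.T (A.carrier ⊕ PUnit.{u + 1})) :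
    ∃ r : M.UPoly A, ∀ a, M.evalPoly A r a = M.evalPoly A q (M.evalPoly A p a) := by
  refine ⟨M.mult (M.map (Sum.elim (fun a => M.unit (Sum.inl a)) fun _ => p) q), fun a => ?_⟩
  unfold evalPoly
  rw [M.mult_nat, A.mul_assoc, ← M.map_comp, ← M.map_comp]
  congr 2
  funext x
  cases x with
  | inl b =>
    change A.mul (M.map _ (M.unit _)) = b
    rw [M.unit_nat, A.mul_unit]
    rfl
  | inr _ => rfl

/-- Elements that no unary polynomial separates with respect to `F`. -/
def polySetoid (A : M.Alg) (F : Set A.carrier) : Setoid A.carrier where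
  r a b := ∀ p : M.UPoly A, M.evalPoly A p a ∈ F ↔ M.evalPoly A p b ∈ F
  iseqv :=
    { refl := fun _ _ => Iff.rfl
      symm := fun h p => (h p).symm
      trans := fun h h' p => (h p).trans (h' p) }

theorem polySetoid_evalPoly {A : M.Alg} {F : Set A.carrier} {a b : A.carrier}
    (h : polySetoid A F a b) (p : M.UPoly A) :
    polySetoid A F (M.evalPoly A p a) (M.evalPoly A p b) := by
  intro q
  obtain ⟨r, hr⟩ := exists_evalPoly_comp A q p
  rw [← hr, ← hr]
  exact h r

open Classical in
/-- On a finite algebra, replacing arguments by equivalent ones preserves the class of the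
product. -/
theorem polySetoid_mul_map {A : M.Alg} [Finite A.carrier] {F : Set A.carrier}
    {k : A.carrier → A.carrier} (hk : ∀ a, polySetoid A F a (k a)) (w : M.T A.carrier) :
    polySetoid A F (A.mul w) (A.mul (M.map k w)) := by
  have := Fintype.ofFinite A.carrier
  have key : ∀ S : Finset A.carrier,
      polySetoid A F (A.mul w) (A.mul (M.map (fun a => if a ∈ S then k a else a) w)) := by
    intro S
    induction S using Finset.induction_on with
    | empty =>
      rw [map_eq_self (fun a => if_neg (Finset.notMem_empty a))]
    | insert c S hc ih =>
      let p : M.UPoly A := M.map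
        (fun a => if a = c then Sum.inr PUnit.unit else Sum.inl (if a ∈ S then k a else a)) w
      have hp : ∀ d, M.evalPoly A p d =
          A.mul (M.map (fun a => if a = c then d else if a ∈ S then k a else a) w) := by
        intro d
        unfold evalPoly
        rw [← M.map_comp]
        congr 2
        funext a
        by_cases h : a = c <;> simp [h]
      have step := polySetoid_evalPoly (hk c) p
      rw [hp, hp] at step
      have hleft : (fun a => if a = c then c else if a ∈ S then k a else a) =
          fun a => if a ∈ S then k a else a := by
        funext a
        by_cases h : a = c <;> simp [h, hc]
      have hright : (fun a => if a = c then k c else if a ∈ S then k a else a) =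
          fun a => if a ∈ insert c S then k a else a := by
        funext a
        by_cases h : a = c <;> simp [h]
      rw [hleft, hright] at step
      exact (polySetoid A F).trans ih step
  simpa using key Finset.univ

theorem mk_mul_map_out {A : M.Alg} {s : Setoid A.carrier}
    (hs : ∀ w, s (A.mul w) (A.mul (M.map (fun a => (Quotient.mk s a).out) w)))
    (w : M.T A.carrier) :
    Quotient.mk s (A.mul (M.map Quotient.out (M.map (Quotient.mk s) w))) =
      Quotient.mk s (A.mul w) := by
  rw [← M.map_comp]
  exact (Quotient.sound (hs w)).symm

/-- The quotient of an algebra by a congruence. -/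
noncomputable def quotAlg (A : M.Alg) (s : Setoid A.carrier)
    (hs : ∀ w, s (A.mul w) (A.mul (M.map (fun a => (Quotient.mk s a).out) w))) : M.Alg where
  carrier := Quotient s
  mul w := Quotient.mk s (A.mul (M.map Quotient.out w))
  mul_unit a := by
    rw [M.unit_nat, A.mul_unit, Quotient.out_eq]
  mul_assoc w := by
    rw [M.mult_nat, A.mul_assoc, ← mk_mul_map_out hs]
    simp only [← M.map_comp]
    rfl

theorem isHom_quotAlg_mk (A : M.Alg) (s : Setoid A.carrier)
    (hs : ∀ w, s (A.mul w) (A.mul (M.map (fun a => (Quotient.mk s a).out) w))) :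
    M.IsHom A (quotAlg A s hs) (Quotient.mk s) := fun w => (mk_mul_map_out hs w).symm

/-- A Boolean algebra of subsets of a finite set contains every set whose points it separates
from those of the complement. -/
theorem mem_of_separates {X : Type*} [Finite X] {C : Set X → Prop} (h_empty : C ∅)
    (h_union : ∀ S S', C S → C S' → C (S ∪ S')) (h_inter : ∀ S S', C S → C S' → C (S ∩ S'))
    (h_compl : ∀ S, C S → C Sᶜ) {G : Set X}
    (hG : ∀ x ∈ G, ∀ y ∉ G, ∃ S, C S ∧ x ∈ S ∧ y ∉ S) : C G := by
  have point : ∀ x ∈ G, ∃ S, C S ∧ x ∈ S ∧ S ⊆ G := by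
    intro x hx
    have key : ∀ Y : Set X, Y.Finite → Y ⊆ Gᶜ → ∃ S, C S ∧ x ∈ S ∧ ∀ y ∈ Y, y ∉ S := by
      intro Y hY
      induction Y, hY using Set.Finite.induction_on with
      | empty => exact fun _ => ⟨∅ᶜ, h_compl _ h_empty, by simp, by simp⟩
      | @insert y Y _ _ ih =>
        intro hsub
        obtain ⟨S, hS, hxS, hYS⟩ := ih fun z hz => hsub (Or.inr hz)
        obtain ⟨S', hS', hxS', hyS'⟩ := hG x hx y (hsub (Or.inl rfl))
        refine ⟨S ∩ S', h_inter _ _ hS hS', ⟨hxS, hxS'⟩, ?_⟩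
        rintro z (rfl | hz) hzS
        · exact hyS' hzS.2
        · exact hYS z hz hzS.1
    obtain ⟨S, hS, hxS, hYS⟩ := key Gᶜ (Set.toFinite _) subset_rfl
    exact ⟨S, hS, hxS, fun z hz => by_contra fun hzG => hYS z hzG hz⟩
  have key : ∀ Y : Set X, Y.Finite → Y ⊆ G → ∃ S, C S ∧ Y ⊆ S ∧ S ⊆ G := by
    intro Y hY
    induction Y, hY using Set.Finite.induction_on with
    | empty => exact fun _ => ⟨∅, h_empty, subset_rfl, Set.empty_subset G⟩
    | @insert y Y _ _ ih =>
      intro hsub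
      obtain ⟨S, hS, hYS, hSG⟩ := ih fun z hz => hsub (Or.inr hz)
      obtain ⟨S', hS', hyS', hSG'⟩ := point y (hsub (Or.inl rfl))
      refine ⟨S ∪ S', h_union _ _ hS hS', ?_, Set.union_subset hSG hSG'⟩
      exact Set.insert_subset (Or.inr hyS') (hYS.trans Set.subset_union_left)
  obtain ⟨S, hS, hGS, hSG⟩ := key G (Set.toFinite _) subset_rfl
  rwa [hGS.antisymm hSG]

/-- For a class closed under Boolean combinations, preimages of subsets along a fixed map into a
finite set belong to the class once those that do separate points. -/
theorem ClosedBool.preimage_mem {Q : ∀ Sig : Type u, Set (M.T Sig) → Prop}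
    (hQ : M.ClosedBool Q) {Sig : Type u} {X : Type*} [Finite X] (h : M.T Sig → X)
    (h_empty : Q Sig ∅) {G : Set X}
    (hG : ∀ x ∈ G, ∀ y ∉ G, ∃ S, Q Sig (h ⁻¹' S) ∧ x ∈ S ∧ y ∉ S) : Q Sig (h ⁻¹' G) :=
  mem_of_separates (C := fun S => Q Sig (h ⁻¹' S)) h_empty
    (fun _ _ => hQ.1 Sig _ _) (fun _ _ => hQ.2.1 Sig _ _) (fun _ => hQ.2.2 Sig _) hG

theorem IsAlgPV.of_ker_le {P : M.Alg → Prop} (hP : M.IsAlgPV P) {X A B : M.Alg} (hA : P A)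
    {g : X.carrier → A.carrier} (hg : M.IsHom X A g) {h : X.carrier → B.carrier}
    (hh : M.IsHom X B h) (hs : Function.Surjective h)
    (hker : ∀ x y, g x = g y → h x = h y) : P B := by
  have hcomp : (h ∘ Set.rangeSplitting g) ∘ Set.rangeFactorization g = h :=
    funext fun x => hker _ _ (Set.apply_rangeSplitting g _)
  refine hP.2.2.1 (M.subAlg A (Set.range g) hg.mul_mem_range) B (h ∘ Set.rangeSplitting g)
    (hP.2.2.2 A _ _ hA) ?_ ?_
  · refine IsHom.of_comp_surjective hg.rangeFactorization Set.rangeFactorization_surjective ?_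
    rw [← hcomp] at hh
    exact hh
  · refine Function.Surjective.of_comp (g := Set.rangeFactorization g) ?_
    rw [← hcomp] at hs
    exact hs

theorem isPolyLangPV_makelang {P : M.Alg → Prop} (hP : M.IsAlgPV P) :
    M.IsPolyLangPV (M.makelang P) := by
  refine ⟨?_, ⟨?_, ?_, ?_⟩, ?_, ?_⟩
  · rintro Sig L ⟨hSig, B, h, F, hB, hh, rfl⟩
    exact ⟨hSig, B, h, F, hP.1 B hB, hh, rfl⟩
  · rintro Sig L K ⟨hSig, B, h, F, hB, hh, rfl⟩ ⟨-, B', h', F', hB', hh', rfl⟩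
    exact ⟨hSig, M.prodAlg B B', fun w => (h w, h' w), {x | x.1 ∈ F ∨ x.2 ∈ F'},
      hP.2.1 B B' hB hB', isHom_prod hh hh', rfl⟩
  · rintro Sig L K ⟨hSig, B, h, F, hB, hh, rfl⟩ ⟨-, B', h', F', hB', hh', rfl⟩
    exact ⟨hSig, M.prodAlg B B', fun w => (h w, h' w), {x | x.1 ∈ F ∧ x.2 ∈ F'},
      hP.2.1 B B' hB hB', isHom_prod hh hh', rfl⟩
  · rintro Sig L ⟨hSig, B, h, F, hB, hh, rfl⟩
    exact ⟨hSig, B, h, Fᶜ, hB, hh, rfl⟩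
  · rintro Sig Gam L f hGam ⟨-, B, h, F, hB, hh, rfl⟩ hf
    exact ⟨hGam, B, h ∘ f, F, hB, IsHom.comp (B := M.Free Sig) hh hf, rfl⟩
  · rintro Sig L p ⟨hSig, B, h, F, hB, hh, rfl⟩
    refine ⟨hSig, B, h, {b | M.evalPoly B (M.map (Sum.map h id) p) b ∈ F}, hB, hh, ?_⟩
    ext w
    exact iff_of_eq (congrArg (· ∈ F) (IsHom.map_evalPoly (A := M.Free Sig) hh p w))

theorem makealg_makelang {P : M.Alg → Prop} (hP : M.IsAlgPV P) :
    M.makealg (M.makelang P) = P := by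
  funext B
  apply propext
  constructor
  · rintro ⟨hfin, hB⟩
    have hh : M.IsHom (M.Free B.carrier) B B.mul := B.mul_assoc
    have key : ∀ S : Set B.carrier, S.Finite → ∃ (A : M.Alg) (g : M.T B.carrier → A.carrier),
        P A ∧ M.IsHom (M.Free B.carrier) A g ∧
          ∀ x y, g x = g y → B.mul x ∈ S → B.mul x = B.mul y := by
      intro S hS
      induction S, hS using Set.Finite.induction_on with
      | empty =>
        obtain ⟨-, A, g, -, hA, hg, -⟩ := hB B.carrier B.mul ∅ hfin hh
        exact ⟨A, g, hA, hg, fun _ _ _ h => h.elim⟩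
      | @insert b S _ _ ih =>
        obtain ⟨A, g, hA, hg, hS⟩ := ih
        obtain ⟨-, A', g', F', hA', hg', hF'⟩ := hB B.carrier B.mul {b} hfin hh
        refine ⟨M.prodAlg A A', fun w => (g w, g' w), hP.2.1 _ _ hA hA', isHom_prod hg hg', ?_⟩
        intro x y hxy hx
        obtain ⟨h1, h2⟩ := Prod.ext_iff.mp hxy
        obtain hx | hx := hx
        · have hmem : ∀ z, B.mul z = b ↔ g' z ∈ F' := fun z => Set.ext_iff.mp hF' z
          rw [hx]
          refine ((hmem y).2 ?_).symm
          rw [← show g' x = g' y from h2]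
          exact (hmem x).1 hx
        · exact hS x y h1 hx
    obtain ⟨A, g, hA, hg, hker⟩ := key Set.univ (Set.toFinite _)
    exact hP.of_ker_le (X := M.Free B.carrier) hA hg hh (fun b => ⟨M.unit b, B.mul_unit b⟩)
      fun x y hxy => hker x y hxy trivial
  · exact fun hB => ⟨hP.1 B hB, fun _ h F hSig hh => ⟨hSig, B, h, F, hB, hh, rfl⟩⟩

theorem isAlgPV_makealg {Q : ∀ Sig : Type u, Set (M.T Sig) → Prop} (hQ : M.ClosedBool Q) :
    M.IsAlgPV (M.makealg Q) := by
  refine ⟨fun A hA => hA.1, ?_, ?_, ?_⟩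
  · rintro A B ⟨hA, hAQ⟩ ⟨hB, hBQ⟩
    have hfin : Finite (M.prodAlg A B).carrier := inferInstanceAs (Finite (A.carrier × B.carrier))
    refine ⟨hfin, fun Sig h F hSig hh => ?_⟩
    have h1 := fun G => hAQ Sig (Prod.fst ∘ h) G hSig ((isHom_fst A B).comp hh)
    have h2 := fun G => hBQ Sig (Prod.snd ∘ h) G hSig ((isHom_snd A B).comp hh)
    refine hQ.preimage_mem h (h1 ∅) fun x hx y hy => ?_
    by_cases hxy : x.1 = y.1
    · refine ⟨Prod.snd ⁻¹' {x.2}, h2 _, rfl, fun h' => hy ?_⟩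
      rwa [← show x = y from Prod.ext hxy (Eq.symm h')]
    · exact ⟨Prod.fst ⁻¹' {x.1}, h1 _, rfl, fun h' => hxy (Eq.symm h')⟩
  · rintro A B q ⟨hA, hAQ⟩ hq hs
    refine ⟨Finite.of_surjective q hs, fun Sig h F hSig hh => ?_⟩
    obtain ⟨g, hg, hgh⟩ := hq.exists_lift hs hh
    rw [← funext hgh]
    exact hAQ Sig g (q ⁻¹' F) hSig hg
  · rintro A S hS ⟨hA, hAQ⟩
    refine ⟨inferInstanceAs (Finite ↥S), fun Sig h F hSig hh => ?_⟩
    have := hAQ Sig (Subtype.val ∘ h) (Subtype.val '' F) hSig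
      ((isHom_subtype_val A S hS).comp hh)
    exact (congrArg (fun G => Q Sig (h ⁻¹' G))
      (Set.preimage_image_eq F Subtype.val_injective)).mp this

/-- Languages of a polynomial language pseudovariety are recognised by a finite algebra all of
whose recognised languages belong to the pseudovariety. -/
theorem IsPolyLangPV.mem_makelang_makealg {Q : ∀ Sig : Type u, Set (M.T Sig) → Prop}
    (hQ : M.IsPolyLangPV Q) {Sig : Type u} {L : Set (M.T Sig)} (hL : Q Sig L) :
    M.makelang (M.makealg Q) Sig L := by
  obtain ⟨hClass, hBool, hPre, hDeriv⟩ := hQ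
  obtain ⟨hSig, C, g₀, F₀, hC, hg₀, hLF₀⟩ := hClass Sig L hL
  obtain ⟨A, g, F, hA, hg, hgs, rfl⟩ : ∃ (A : M.Alg) (g : M.T Sig → A.carrier)
      (F : Set A.carrier), Finite A.carrier ∧ M.IsHom (M.Free Sig) A g ∧
        Function.Surjective g ∧ L = g ⁻¹' F :=
    ⟨M.subAlg C _ hg₀.mul_mem_range, Set.rangeFactorization g₀, Subtype.val ⁻¹' F₀,
      inferInstanceAs (Finite ↥(Set.range g₀)), hg₀.rangeFactorization,
      Set.rangeFactorization_surjective, hLF₀⟩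
  have h_empty : Q Sig ∅ := by
    have := hBool.2.1 Sig _ _ hL (hBool.2.2 Sig _ hL)
    rwa [Set.inter_compl_self] at this
  have hpoly : ∀ p : M.UPoly A, Q Sig (g ⁻¹' {a | M.evalPoly A p a ∈ F}) := by
    intro p
    obtain ⟨p', rfl⟩ := map_surjective (M := M) (hgs.sumMap Function.surjective_id) p
    convert hDeriv Sig _ p' hL using 1
    ext w
    exact iff_of_eq (congrArg (· ∈ F) (IsHom.map_evalPoly (A := M.Free Sig) hg p' w)).symm
  let s := polySetoid A F
  have hs : ∀ w, s (A.mul w) (A.mul (M.map (fun a => (Quotient.mk s a).out) w)) :=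
    polySetoid_mul_map fun a => s.symm (Quotient.mk_out (s := s) a)
  have hmk := isHom_quotAlg_mk A s hs
  have hclass : ∀ G : Set (Quotient s), Q Sig (g ⁻¹' (Quotient.mk s ⁻¹' G)) := by
    intro G
    refine hBool.preimage_mem g h_empty fun x hx y hy => ?_
    have hxy : ¬ s x y := fun h => hy (by
      change Quotient.mk s y ∈ G
      rw [← Quotient.sound h]
      exact hx)
    obtain ⟨p, hp⟩ := not_forall.mp hxy
    by_cases hpx : M.evalPoly A p x ∈ F
    · exact ⟨_, hpoly p, hpx, fun hpy => hp (iff_of_true hpx hpy)⟩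
    · exact ⟨{a | M.evalPoly A p a ∈ F}ᶜ, hBool.2.2 Sig _ (hpoly p), hpx, fun hpy => hp (iff_of_false hpx hpy)⟩
  refine ⟨hSig, quotAlg A s hs, Quotient.mk s ∘ g, Quotient.mk s '' F, ⟨?_, ?_⟩,
    hmk.comp hg, ?_⟩
  · exact inferInstanceAs (Finite (Quotient s))
  · intro Gam k G hGam hk
    obtain ⟨f, hf, hfk⟩ := IsHom.exists_lift (hmk.comp hg)
      ((Quotient.mk_surjective (s := s)).comp hgs) hk
    rw [← funext hfk]
    exact hPre Sig Gam _ f hGam (hclass G) hf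
  · ext w
    refine ⟨fun hw => ⟨g w, hw, rfl⟩, ?_⟩
    rintro ⟨a, ha, haw⟩
    have := Quotient.exact haw (M.unit (Sum.inr PUnit.unit))
    rw [evalPoly_unit_inr, evalPoly_unit_inr] at this
    exact this.1 ha

theorem makelang_makealg {Q : ∀ Sig : Type u, Set (M.T Sig) → Prop} (hQ : M.IsPolyLangPV Q) :
    M.makelang (M.makealg Q) = Q := by
  funext Sig L
  apply propext
  refine ⟨?_, hQ.mem_makelang_makealg⟩
  rintro ⟨hSig, B, h, F, hB, hh, rfl⟩
  exact hB.2 Sig h F hSig hh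

end SetMonad

/-- **Polynomial Pseudovariety Theorem.** In the setting of sets, `makelang` is a
bijection between algebra pseudovarieties and polynomial language pseudovarieties, with
inverse `makealg`. -/
theorem polynomial_pseudovariety_theorem (M : SetMonad.{u}) :
    (∀ P : M.Alg → Prop, M.IsAlgPV P →
      M.IsPolyLangPV (M.makelang P) ∧ M.makealg (M.makelang P) = P) ∧
    (∀ Q : ∀ Sig : Type u, Set (M.T Sig) → Prop, M.IsPolyLangPV Q →
      M.IsAlgPV (M.makealg Q) ∧ M.makelang (M.makealg Q) = Q) := by
  exact ⟨fun _ hP => ⟨SetMonad.isPolyLangPV_makelang hP, SetMonad.makealg_makelang hP⟩,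
    fun _ hQ => ⟨SetMonad.isAlgPV_makealg hQ.2.1, SetMonad.makelang_makealg hQ⟩⟩
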